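/- arXiv:2203.06623 — 2 statements merged into one kernel-verified Lean document; each statement's English description precedes it below -/
import Mathlib

section
/- Let α > 1 and let σ ∈ ℝ with σ > −1/α. Then for every t ∈ ℚ_p, t ≠ 0, the integral I_{α,σ} = ∫_{|y|_p < |t|_p} | |t|_p^{α−1} − |y|_p^{α−1} | · |y|_p^{ασ} dy converges and equals d_{α,σ} |t|_p^{α(σ+1)}, where d_{α,σ} = (1 − p^{−1}) · ((p^{α−1} − 1)/((1 − p^{−ασ−1})(p^{α} − p^{−ασ}))) · p^{−ασ} is positive and independent of t. -/
open MeasureTheory Metric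

noncomputable section

variable (p : ℕ) [Fact p.Prime]

instance : MeasurableSpace ℚ_[p] := borel _
instance : BorelSpace ℚ_[p] := ⟨rfl⟩

/-- The closed unit ball of `ℚ_[p]` as a positive compact set. -/
def unitBallPC : TopologicalSpace.PositiveCompacts ℚ_[p] where
  carrier := closedBall 0 1
  isCompact' := isCompact_closedBall 0 1
  interior_nonempty' := ⟨0, mem_interior_iff_mem_nhds.2
    (Filter.mem_of_superset (ball_mem_nhds 0 one_pos) ball_subset_closedBall)⟩

/-- The Haar measure on `ℚ_[p]` normalized so the unit ball has measure 1. -/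
def padicHaar : Measure ℚ_[p] := Measure.addHaarMeasure (unitBallPC p)

/-- A point on the sphere of radius `p^k`. -/
def sph (k : ℤ) : ℚ_[p] := (p : ℚ_[p]) ^ (-k)

/-- A function is radial if it depends only on the p-adic absolute value. -/
def Radial (u : ℚ_[p] → ℝ) : Prop := ∀ x y : ℚ_[p], ‖x‖ = ‖y‖ → u x = u y

/-- The integrand of the Vladimirov operator `D^α` at `x`. -/
def Dker (α : ℝ) (u : ℚ_[p] → ℝ) (x : ℚ_[p]) : ℚ_[p] → ℝ :=
  fun y => ‖y‖ ^ (-α - 1) * (u (x - y) - u x)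

/-- The Vladimirov fractional differentiation operator. -/
def Dop (α : ℝ) (u : ℚ_[p] → ℝ) (x : ℚ_[p]) : ℝ :=
  ((1 - (p : ℝ) ^ α) / (1 - (p : ℝ) ^ (-α - 1))) * ∫ y, Dker p α u x y ∂(padicHaar p)

/-- The kernel of the fractional integral `I^α`. -/
def Iker (α : ℝ) (x y : ℚ_[p]) : ℝ :=
  if α = 1 then Real.log ‖x - y‖ - Real.log ‖y‖
  else ‖x - y‖ ^ (α - 1) - ‖y‖ ^ (α - 1)

/-- The constant in front of the fractional integral. -/
def Icoef (α : ℝ) : ℝ :=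
  if α = 1 then (1 - (p : ℝ)) / (p * Real.log p)
  else (1 - (p : ℝ) ^ (-α)) / (1 - (p : ℝ) ^ (α - 1))

/-- The p-adic fractional integral `I^α`. -/
def Iop (α : ℝ) (u : ℚ_[p] → ℝ) (x : ℚ_[p]) : ℝ :=
  Icoef p α * ∫ y in {y : ℚ_[p] | ‖y‖ ≤ ‖x‖}, Iker p α x y * u y ∂(padicHaar p)

end

theorem haar_closedBall_succ (p : ℕ) [Fact p.Prime] (k : ℤ) :
    padicHaar p (closedBall 0 ((p : ℝ) ^ (k + 1))) =
      p * padicHaar p (closedBall 0 ((p : ℝ) ^ k)) := by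
  have hp0 : (p : ℚ_[p]) ≠ 0 := by exact_mod_cast (Fact.out : p.Prime).ne_zero
  have hq0 : (0 : ℝ) < p := by exact_mod_cast (Fact.out : p.Prime).pos
  have key : ∀ x c : ℚ_[p], ‖x - c * (p : ℚ_[p]) ^ (-(k + 1))‖ ≤ (p : ℝ) ^ k ↔
      ‖x * (p : ℚ_[p]) ^ (k + 1) - c‖ < 1 := by
    intro x c
    have h1 : x - c * (p : ℚ_[p]) ^ (-(k + 1)) =
        (x * (p : ℚ_[p]) ^ (k + 1) - c) * (p : ℚ_[p]) ^ (-(k + 1)) := by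
      rw [sub_mul, mul_assoc, ← zpow_add₀ hp0]; simp
    rw [Padic.norm_le_pow_iff_norm_lt_pow_add_one, h1, norm_mul, Padic.norm_p_zpow, neg_neg]
    exact mul_lt_iff_lt_one_left (zpow_pos hq0 _)
  have hU : closedBall (0 : ℚ_[p]) ((p : ℝ) ^ (k + 1)) =
      ⋃ i ∈ Finset.range p, closedBall ((i : ℚ_[p]) * (p : ℚ_[p]) ^ (-(k + 1))) ((p : ℝ) ^ k) := by
    ext x
    simp only [Set.mem_iUnion, mem_closedBall, dist_eq_norm, sub_zero, exists_prop,
      Finset.mem_range, key]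
    have hx : ‖x‖ ≤ (p : ℝ) ^ (k + 1) ↔ ‖x * (p : ℚ_[p]) ^ (k + 1)‖ ≤ 1 := by
      rw [norm_mul, Padic.norm_p_zpow, zpow_neg, ← div_eq_mul_inv, div_le_one (zpow_pos hq0 _)]
    rw [hx]
    constructor
    · intro h
      obtain ⟨w, hw⟩ : ∃ w : ℤ_[p], (w : ℚ_[p]) = x * (p : ℚ_[p]) ^ (k + 1) := ⟨⟨_, h⟩, rfl⟩
      obtain ⟨n, hn, hm⟩ := PadicInt.exists_mem_range w
      refine ⟨n, hn, ?_⟩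
      rw [IsLocalRing.mem_maximalIdeal, PadicInt.mem_nonunits] at hm
      rw [PadicInt.norm_def, PadicInt.coe_sub, PadicInt.coe_natCast, hw] at hm
      exact hm
    · rintro ⟨i, -, h⟩
      have h2 : ‖(i : ℚ_[p])‖ ≤ 1 := by
        simpa using Padic.norm_int_le_one (p := p) (i : ℤ)
      have h3 := Padic.nonarchimedean (x * (p : ℚ_[p]) ^ (k + 1) - (i : ℚ_[p])) (i : ℚ_[p])
      rw [sub_add_cancel] at h3
      exact h3.trans (max_le h.le h2)
  have hd : (↑(Finset.range p) : Set ℕ).PairwiseDisjoint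
      (fun i : ℕ => closedBall ((i : ℚ_[p]) * (p : ℚ_[p]) ^ (-(k + 1))) ((p : ℝ) ^ k)) := by
    intro i hi j hj hij
    refine Set.disjoint_left.2 fun x hxi hxj => hij ?_
    simp only [mem_closedBall, dist_eq_norm, key] at hxi hxj
    have h3 := Padic.nonarchimedean (x * (p : ℚ_[p]) ^ (k + 1) - (j : ℚ_[p]))
      (-(x * (p : ℚ_[p]) ^ (k + 1) - (i : ℚ_[p])))
    rw [norm_neg] at h3
    have h4 : ‖(((i : ℤ) - (j : ℤ) : ℤ) : ℚ_[p])‖ < 1 := by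
      refine lt_of_le_of_lt (le_of_eq_of_le ?_ h3) (max_lt hxj hxi)
      congr 1; push_cast; ring
    rw [Padic.norm_intCast_lt_one_iff] at h4
    simp only [Finset.coe_range, Set.mem_Iio] at hi hj
    have h5 := Int.eq_zero_of_abs_lt_dvd h4 (by rw [abs_lt]; constructor <;> omega)
    omega
  have hinv : (padicHaar p).IsAddLeftInvariant := by
    unfold padicHaar; infer_instance
  rw [hU, measure_biUnion_finset hd (fun _ _ => measurableSet_closedBall)]
  have : ∀ c : ℚ_[p], padicHaar p (closedBall c ((p : ℝ) ^ k)) =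
      padicHaar p (closedBall 0 ((p : ℝ) ^ k)) := by
    intro c
    rw [← measure_preimage_add (padicHaar p) c (closedBall c ((p : ℝ) ^ k))]
    congr 1
    ext x
    simp [dist_eq_norm]
  simp [this]

theorem haar_closedBall (p : ℕ) [Fact p.Prime] (k : ℤ) :
    (padicHaar p).real (closedBall 0 ((p : ℝ) ^ k)) = (p : ℝ) ^ k := by
  have hq0 : (p : ℝ) ≠ 0 := by exact_mod_cast (Fact.out : p.Prime).ne_zero
  have hs : ∀ k : ℤ, (padicHaar p).real (closedBall 0 ((p : ℝ) ^ (k + 1))) =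
      p * (padicHaar p).real (closedBall 0 ((p : ℝ) ^ k)) := by
    intro k
    simp [measureReal_def, haar_closedBall_succ]
  induction k using Int.induction_on with
  | zero =>
    have : padicHaar p (closedBall 0 1) = 1 :=
      Measure.addHaarMeasure_self (K₀ := unitBallPC p)
    simp [measureReal_def, this]
  | succ i ih => rw [hs, ih, zpow_add_one₀ hq0, mul_comm]
  | pred i ih =>
    have h := hs (-(i : ℤ) - 1)
    rw [sub_add_cancel, ih] at h
    have h2 : (p : ℝ) ^ (-(i : ℤ) - 1) = (p : ℝ) ^ (-(i : ℤ)) * (p : ℝ)⁻¹ := zpow_sub_one₀ hq0 _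
    have h3 : (padicHaar p).real (closedBall 0 ((p : ℝ) ^ (-(i : ℤ) - 1))) =
        (p : ℝ) ^ (-(i : ℤ)) * (p : ℝ)⁻¹ := by
      rw [h]; field_simp
    rw [h3, h2]

theorem haar_sphere (p : ℕ) [Fact p.Prime] (k : ℤ) :
    (padicHaar p).real (sphere 0 ((p : ℝ) ^ k)) = (1 - (p : ℝ)⁻¹) * (p : ℝ) ^ k := by
  have hq0 : (p : ℝ) ≠ 0 := by exact_mod_cast (Fact.out : p.Prime).ne_zero
  have hq1 : (1 : ℝ) ≤ p := by exact_mod_cast (Fact.out : p.Prime).one_lt.le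
  have hfin : IsFiniteMeasureOnCompacts (padicHaar p) := by
    unfold padicHaar; infer_instance
  have hS : sphere (0 : ℚ_[p]) ((p : ℝ) ^ k) =
      closedBall 0 ((p : ℝ) ^ k) \ closedBall 0 ((p : ℝ) ^ (k - 1)) := by
    ext x
    simp only [mem_sphere, Set.mem_sdiff, mem_closedBall, dist_zero_right,
      Padic.norm_le_pow_iff_norm_lt_pow_add_one x (k - 1), sub_add_cancel, not_lt]
    exact le_antisymm_iff
  rw [hS, measureReal_sdiff (closedBall_subset_closedBall
    (zpow_le_zpow_right₀ hq1 (by omega))) measurableSet_closedBall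
    (isCompact_closedBall _ _).measure_lt_top.ne, haar_closedBall, haar_closedBall,
    zpow_sub_one₀ hq0]
  ring

/-- the integral `I_{α,σ}` for `α > 1`. -/
theorem I_alpha_sigma_gt_one (p : ℕ) [Fact p.Prime] (α σ : ℝ) (hα : 1 < α) (hσ : -1 / α < σ)
    (t : ℚ_[p]) (ht : t ≠ 0) :
    IntegrableOn (fun y => |‖t‖ ^ (α - 1) - ‖y‖ ^ (α - 1)| * ‖y‖ ^ (α * σ))
      {y : ℚ_[p] | ‖y‖ < ‖t‖} (padicHaar p) ∧
    0 < (1 - (p : ℝ)⁻¹) * (((p : ℝ) ^ (α - 1) - 1) /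
        ((1 - (p : ℝ) ^ (-α * σ - 1)) * ((p : ℝ) ^ α - (p : ℝ) ^ (-α * σ)))) *
        (p : ℝ) ^ (-α * σ) ∧
    (∫ y in {y : ℚ_[p] | ‖y‖ < ‖t‖},
        |‖t‖ ^ (α - 1) - ‖y‖ ^ (α - 1)| * ‖y‖ ^ (α * σ) ∂(padicHaar p)) =
      (1 - (p : ℝ)⁻¹) * (((p : ℝ) ^ (α - 1) - 1) /
          ((1 - (p : ℝ) ^ (-α * σ - 1)) * ((p : ℝ) ^ α - (p : ℝ) ^ (-α * σ)))) *
        (p : ℝ) ^ (-α * σ) * ‖t‖ ^ (α * (σ + 1)) := by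
  have hq1 : (1 : ℝ) < p := by exact_mod_cast (Fact.out : p.Prime).one_lt
  have hq0 : (0 : ℝ) < p := one_pos.trans hq1
  have hα0 : 0 < α := one_pos.trans hα
  have hs : 0 < α * σ + 1 := by
    rw [div_lt_iff₀ hα0] at hσ; nlinarith
  have hfin : IsFiniteMeasureOnCompacts (padicHaar p) := by
    unfold padicHaar; infer_instance
  have hna : NullSingletonClass (padicHaar p) := by
    unfold padicHaar; infer_instance
  set q : ℝ := (p : ℝ) with hq
  set N : ℤ := -t.valuation with hN
  have hT : ‖t‖ = q ^ N := Padic.norm_eq_zpow_neg_valuation ht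
  set T : ℝ := ‖t‖ with hTdef
  have hT0 : 0 < T := norm_pos_iff.2 ht
  set x : ℝ := q ^ (-α * σ - 1) with hx
  set z : ℝ := q ^ (-(α * (σ + 1))) with hz
  have hx0 : 0 < x := Real.rpow_pos_of_pos hq0 _
  have hz0 : 0 < z := Real.rpow_pos_of_pos hq0 _
  have hx1 : x < 1 := Real.rpow_lt_one_of_one_lt_of_neg hq1 (by linarith)
  have hz1 : z < 1 := Real.rpow_lt_one_of_one_lt_of_neg hq1 (by nlinarith)
  -- the positive constant
  have hA : 1 < q ^ (α - 1) := Real.one_lt_rpow hq1 (by linarith)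
  have hD : 0 < q ^ α - q ^ (-α * σ) := by
    rw [sub_pos]
    exact Real.rpow_lt_rpow_of_exponent_lt hq1 (by nlinarith)
  have hc : 0 < 1 - q⁻¹ := by
    rw [sub_pos]; exact inv_lt_one_of_one_lt₀ hq1
  have hpos : 0 < (1 - q⁻¹) * ((q ^ (α - 1) - 1) /
        ((1 - x) * (q ^ α - q ^ (-α * σ)))) * q ^ (-α * σ) := by
    have h1 : 0 < q ^ (α - 1) - 1 := by linarith
    have h2 : 0 < 1 - x := by linarith
    have h3 : 0 < q ^ (-α * σ) := Real.rpow_pos_of_pos hq0 _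
    positivity
  set C : ℝ := (1 - q⁻¹) * ((q ^ (α - 1) - 1) /
        ((1 - x) * (q ^ α - q ^ (-α * σ)))) * q ^ (-α * σ) with hC
  have hCeq : C = (1 - q⁻¹) * (x / (1 - x) - z / (1 - z)) := by
    have e1 : q ^ (α - 1) = q ^ α / q := by rw [Real.rpow_sub hq0, Real.rpow_one]
    have e2 : q ^ (-α * σ) = x * q := by
      rw [hx, Real.rpow_sub hq0, Real.rpow_one]; field_simp
    have e3 : z = x * q / q ^ α := by
      rw [← e2, hz, ← Real.rpow_sub hq0]; congr 1; ring
    have hqa : 0 < q ^ α := Real.rpow_pos_of_pos hq0 _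
    rw [e2] at hD
    rw [hC, e1, e2, e3]
    have h2 : 1 - x ≠ 0 := by linarith
    have h3 : 1 - x * q / q ^ α ≠ 0 := by rw [← e3]; linarith
    have h4 : q ^ α - x * q ≠ 0 := hD.ne'
    generalize q ^ α = a at *
    have h5 : x * q / a / (1 - x * q / a) = x * q / (a - x * q) := by
      rw [div_div, mul_sub, mul_one, mul_div_cancel₀ _ hqa.ne']
    rw [h5]
    obtain ⟨d, hd⟩ : ∃ d, d = a - x * q := ⟨_, rfl⟩
    rw [← hd] at h4 ⊢
    have ha : a = d + x * q := by rw [hd]; ring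
    rw [ha]
    field_simp
    ring
  -- spheres
  let r : ℕ → ℝ := fun j => q ^ (N - 1 - (j : ℤ))
  have hr0 : ∀ j, 0 < r j := fun j => zpow_pos hq0 _
  have hrT : ∀ j, r j = T * q ^ (-((j : ℝ) + 1)) := by
    intro j
    have : (q : ℝ) ^ (-((j : ℝ) + 1)) = q ^ (-((j : ℤ) + 1)) := by
      rw [← Real.rpow_intCast]; push_cast; rfl
    rw [this, hT, ← zpow_add₀ hq0.ne']
    change q ^ (N - 1 - (j : ℤ)) = _
    congr 1; ring
  have hrlt : ∀ j, r j < T := by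
    intro j
    rw [hrT]
    exact mul_lt_of_lt_one_right hT0 (Real.rpow_lt_one_of_one_lt_of_neg hq1 (by
      have : (0 : ℝ) ≤ j := Nat.cast_nonneg j
      linarith))
  let S : ℕ → Set ℚ_[p] := fun j => sphere 0 (r j)
  have hU : {y : ℚ_[p] | ‖y‖ < T} = insert 0 (⋃ j, S j) := by
    ext y
    simp only [Set.mem_ofPred_eq, Set.mem_insert_iff, Set.mem_iUnion, S, mem_sphere,
      dist_zero_right]
    constructor
    · intro h
      by_cases hy : y = 0
      · exact Or.inl hy
      · right
        have hyn := Padic.norm_eq_zpow_neg_valuation hy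
        rw [hyn, hT] at h
        have h' := (zpow_lt_zpow_iff_right₀ hq1).1 h
        refine ⟨(N - 1 + y.valuation).toNat, ?_⟩
        rw [hyn]
        change _ = q ^ (N - 1 - _)
        congr 1
        rw [Int.toNat_of_nonneg (by omega)]
        ring
    · rintro (rfl | ⟨j, hj⟩)
      · simpa using hT0
      · rw [hj]; exact hrlt j
  have hae : {y : ℚ_[p] | ‖y‖ < T} =ᵐ[padicHaar p] ⋃ j, S j := by
    rw [hU]; exact insert_ae_eq_self _ _
  have hSm : ∀ j, MeasurableSet (S j) := fun j => isClosed_sphere.measurableSet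
  have hSd : Pairwise (Function.onFun Disjoint S) := by
    intro i j hij
    refine Set.disjoint_left.2 fun y hi hj => hij ?_
    simp only [S, mem_sphere, dist_zero_right] at hi hj
    rw [hi] at hj
    have := (zpow_right_inj₀ hq0 hq1.ne').1 hj
    omega
  set f : ℚ_[p] → ℝ := fun y => |T ^ (α - 1) - ‖y‖ ^ (α - 1)| * ‖y‖ ^ (α * σ) with hf
  have hfS : ∀ j, ∀ y ∈ S j, f y = (T ^ (α - 1) - r j ^ (α - 1)) * r j ^ (α * σ) := by
    intro j y hy
    simp only [S, mem_sphere, dist_zero_right] at hy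
    simp only [hf, hy]
    rw [abs_of_nonneg]
    exact sub_nonneg.2 (Real.rpow_le_rpow (hr0 j).le (hrlt j).le (by linarith))
  have hSfin : ∀ j, padicHaar p (S j) ≠ ⊤ := fun j => (isCompact_sphere _ _).measure_lt_top.ne
  have hfi : ∀ j, IntegrableOn f (S j) (padicHaar p) := by
    intro j
    exact (integrableOn_const (hSfin j)).congr_fun (fun y hy => (hfS j y hy).symm) (hSm j)
  have hval : ∀ j, ∫ y in S j, f y ∂(padicHaar p) =
      (1 - q⁻¹) * T ^ (α * (σ + 1)) * (x * x ^ j - z * z ^ j) := by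
    intro j
    rw [setIntegral_congr_fun (hSm j) (hfS j), setIntegral_const, smul_eq_mul]
    have hm : (padicHaar p).real (S j) = (1 - q⁻¹) * r j := haar_sphere p _
    have a1 : r j * r j ^ (α * σ) = T ^ (α * σ + 1) * (x * x ^ j) := by
      rw [mul_comm, ← Real.rpow_add_one (hr0 j).ne', hrT j,
        Real.mul_rpow hT0.le (Real.rpow_nonneg hq0.le _), ← Real.rpow_mul hq0.le, ← pow_succ', hx,
        ← Real.rpow_mul_natCast hq0.le]
      congr 2; push_cast; ring
    have a2 : r j * r j ^ (α * σ) * r j ^ (α - 1) = T ^ (α * (σ + 1)) * (z * z ^ j) := by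
      rw [mul_comm (r j), ← Real.rpow_add_one (hr0 j).ne', ← Real.rpow_add (hr0 j), hrT j,
        Real.mul_rpow hT0.le (Real.rpow_nonneg hq0.le _), ← Real.rpow_mul hq0.le, ← pow_succ', hz,
        ← Real.rpow_mul_natCast hq0.le]
      congr 2
      · ring
      · push_cast; ring
    have a3 : T ^ (α * (σ + 1)) = T ^ (α * σ + 1) * T ^ (α - 1) := by
      rw [← Real.rpow_add hT0]; congr 1; ring
    rw [hm]
    calc _ = (1 - q⁻¹) * (T ^ (α - 1) * (r j * r j ^ (α * σ)) -
          r j * r j ^ (α * σ) * r j ^ (α - 1)) := by ring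
      _ = _ := by rw [a2, a1, a3]; ring
  have hsum : HasSum (fun j => ∫ y in S j, f y ∂(padicHaar p)) (C * T ^ (α * (σ + 1))) := by
    simp only [hval]
    have h := (((hasSum_geometric_of_lt_one hx0.le hx1).mul_left x).sub
      ((hasSum_geometric_of_lt_one hz0.le hz1).mul_left z)).mul_left
        ((1 - q⁻¹) * T ^ (α * (σ + 1)))
    have e : C * T ^ (α * (σ + 1)) = (1 - q⁻¹) * T ^ (α * (σ + 1)) *
        (x * (1 - x)⁻¹ - z * (1 - z)⁻¹) := by rw [hCeq]; ring
    rw [e]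
    exact h
  have hint : IntegrableOn f (⋃ j, S j) (padicHaar p) := by
    refine integrableOn_iUnion_of_summable_integral_norm hfi ?_
    have : ∀ y, ‖f y‖ = f y := fun y => Real.norm_of_nonneg (by simp only [hf]; positivity)
    simpa only [this] using hsum.summable
  refine ⟨hint.congr_set_ae hae, hpos, ?_⟩
  rw [setIntegral_congr_set hae]
  exact (hasSum_integral_iUnion hSm hSd hint).unique hsum
end

section
/- Let 0 < α < 1 and let σ ∈ ℝ with σ > −1. Then for every t ∈ ℚ_p, t ≠ 0, the integral I_{α,σ} = ∫_{|y|_p < |t|_p} | |t|_p^{α−1} − |y|_p^{α−1} | · |y|_p^{ασ} dy converges and equals d_{α,σ} |t|_p^{α(σ+1)}, where d_{α,σ} = (1 − p^{−1}) · ((1 − p^{α−1})/((1 − p^{−ασ−1})(p^{α} − p^{−ασ}))) · p^{−ασ} is positive and independent of t. -/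
open MeasureTheory Metric

section helpers

variable {p : ℕ} [hp : Fact p.Prime]

instance padicHaar_isAddHaar : (padicHaar p).IsAddHaarMeasure := by
  unfold padicHaar; infer_instance

lemma padic_one_lt : (1 : ℝ) < p := by exact_mod_cast hp.out.one_lt

lemma padicHaar_closedBall_center (x : ℚ_[p]) (r : ℝ) :
    padicHaar p (closedBall x r) = padicHaar p (closedBall 0 r) := by
  rw [← measure_preimage_add (padicHaar p) x (closedBall x r)]
  congr 1
  ext y
  simp [dist_eq_norm]

lemma padicHaar_closedBall_succ (n : ℤ) :
    padicHaar p (closedBall 0 ((p : ℝ) ^ (-n))) =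
      p * padicHaar p (closedBall 0 ((p : ℝ) ^ (-(n + 1)))) := by
  have hp1 := padic_one_lt (p := p)
  have hp0 : (p : ℝ) ≠ 0 := by positivity
  have hpQ : (p : ℚ_[p]) ≠ 0 := by exact_mod_cast hp.out.ne_zero
  have hnorm : ‖(p : ℚ_[p]) ^ n‖ = (p : ℝ) ^ (-n) := Padic.norm_p_zpow n
  have hU : closedBall (0 : ℚ_[p]) ((p : ℝ) ^ (-n)) =
      ⋃ i ∈ Finset.range p, closedBall ((i : ℚ_[p]) * (p : ℚ_[p]) ^ n) ((p : ℝ) ^ (-(n + 1))) := by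
    ext x
    simp only [mem_closedBall, dist_zero_right, Set.mem_iUnion, Finset.mem_range, exists_prop]
    simp only [dist_eq_norm, sub_zero]
    constructor
    · intro hx
      have hu : ‖x * (p : ℚ_[p]) ^ (-n)‖ ≤ 1 := by
        rw [norm_mul, Padic.norm_p_zpow, neg_neg]
        calc ‖x‖ * (p : ℝ) ^ n ≤ (p : ℝ) ^ (-n) * (p : ℝ) ^ n := by gcongr
          _ = 1 := by rw [← zpow_add₀ hp0]; simp
      obtain ⟨i, hi, hm⟩ := PadicInt.exists_mem_range (⟨_, hu⟩ : ℤ_[p])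
      refine ⟨i, hi, ?_⟩
      rw [IsLocalRing.mem_maximalIdeal, PadicInt.mem_nonunits, PadicInt.norm_def] at hm
      have h2 : ‖x * (p : ℚ_[p]) ^ (-n) - i‖ < 1 := by exact hm
      have h3 : x - i * (p : ℚ_[p]) ^ n = (x * (p : ℚ_[p]) ^ (-n) - i) * (p : ℚ_[p]) ^ n := by
        rw [sub_mul, mul_assoc, ← zpow_add₀ hpQ]; simp
      rw [Padic.norm_le_pow_iff_norm_lt_pow_add_one, h3, norm_mul, hnorm,
        show -(n + 1) + 1 = -n by ring]
      have : (0 : ℝ) < (p : ℝ) ^ (-n) := by positivity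
      nlinarith
    · rintro ⟨i, hi, h⟩
      have h1 : ‖(i : ℚ_[p]) * (p : ℚ_[p]) ^ n‖ ≤ (p : ℝ) ^ (-n) := by
        rw [norm_mul, hnorm]
        have : ‖(i : ℚ_[p])‖ ≤ 1 := by simpa using Padic.norm_int_le_one (p := p) i
        exact mul_le_of_le_one_left (by positivity) this
      have h2 : (p : ℝ) ^ (-(n + 1)) ≤ (p : ℝ) ^ (-n) :=
        zpow_le_zpow_right₀ hp1.le (by lia)
      have := Padic.nonarchimedean (x - (i : ℚ_[p]) * (p : ℚ_[p]) ^ n) ((i : ℚ_[p]) * (p : ℚ_[p]) ^ n)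
      rw [sub_add_cancel] at this
      exact this.trans (max_le (h.trans h2) h1)
  rw [hU, measure_biUnion_finset]
  · simp [padicHaar_closedBall_center]
  · intro i hi j hj hij
    rw [Function.onFun, Set.disjoint_left]
    intro y hy1 hy2
    apply hij
    simp only [Finset.coe_range, Set.mem_Iio] at hi hj
    rw [mem_closedBall, dist_eq_norm] at hy1 hy2
    have h1 : ‖(((i : ℤ) - (j : ℤ) : ℤ) : ℚ_[p]) * (p : ℚ_[p]) ^ n‖ ≤ (p : ℝ) ^ (-(n + 1)) := by
      have := Padic.nonarchimedean (y - (j : ℚ_[p]) * (p : ℚ_[p]) ^ n) (-(y - (i : ℚ_[p]) * (p : ℚ_[p]) ^ n))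
      rw [norm_neg] at this
      refine le_trans (le_of_eq ?_) (this.trans (max_le hy2 hy1))
      congr 1
      push_cast
      ring
    rw [Padic.norm_le_pow_iff_norm_lt_pow_add_one, norm_mul, hnorm,
        show -(n + 1) + 1 = -n by ring] at h1
    have h0 : (0 : ℝ) < (p : ℝ) ^ (-n) := by positivity
    have h2 : ‖(((i : ℤ) - (j : ℤ) : ℤ) : ℚ_[p])‖ < 1 := by
      by_contra hc
      push Not at hc
      nlinarith
    rw [Padic.norm_intCast_lt_one_iff] at h2
    have := Int.eq_zero_of_abs_lt_dvd h2 (by rw [abs_lt]; constructor <;> lia)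
    lia
  · intro i _
    exact measurableSet_closedBall

lemma padicHaar_real_closedBall (n : ℤ) :
    (padicHaar p).real (closedBall 0 ((p : ℝ) ^ (-n))) = (p : ℝ) ^ (-n) := by
  have hp1 := padic_one_lt (p := p)
  have hp0 : (p : ℝ) ≠ 0 := by positivity
  have hs : ∀ n : ℤ, (padicHaar p).real (closedBall 0 ((p : ℝ) ^ (-n))) =
      p * (padicHaar p).real (closedBall 0 ((p : ℝ) ^ (-(n + 1)))) := by
    intro n
    simp only [Measure.real, padicHaar_closedBall_succ n, ENNReal.toReal_mul,
      ENNReal.toReal_natCast]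
  induction n using Int.induction_on with
  | zero =>
    have : padicHaar p (closedBall 0 1) = 1 := Measure.addHaarMeasure_self (K₀ := unitBallPC p)
    simp [Measure.real, this]
  | succ i ih =>
    have := hs i
    rw [ih] at this
    have h2 : (p : ℝ) ^ (-(i : ℤ)) = p * (p : ℝ) ^ (-((i : ℤ) + 1)) := by
      rw [← zpow_one_add₀ hp0]; congr 1; ring
    rw [h2] at this
    exact (mul_left_cancel₀ hp0 this).symm
  | pred i ih =>
    rw [hs, sub_add_cancel, ih, ← zpow_one_add₀ hp0]; congr 1; ring

lemma padicHaar_real_sphere (n : ℤ) :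
    (padicHaar p).real {y : ℚ_[p] | ‖y‖ = (p : ℝ) ^ (-n)} =
      (p : ℝ) ^ (-n) * (1 - (p : ℝ)⁻¹) := by
  have hp1 := padic_one_lt (p := p)
  have hp0 : (p : ℝ) ≠ 0 := by positivity
  have hS : {y : ℚ_[p] | ‖y‖ = (p : ℝ) ^ (-n)} =
      closedBall 0 ((p : ℝ) ^ (-n)) \ closedBall 0 ((p : ℝ) ^ (-(n + 1))) := by
    ext y
    simp only [Set.mem_ofPred_eq, Set.mem_sdiff, mem_closedBall, dist_zero_right]
    rw [Padic.norm_le_pow_iff_norm_lt_pow_add_one y (-(n + 1)), show -(n + 1) + 1 = -n by ring,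
      not_lt, le_antisymm_iff]
  rw [hS, measureReal_sdiff (closedBall_subset_closedBall
    (zpow_le_zpow_right₀ hp1.le (by lia))) measurableSet_closedBall
    (isCompact_closedBall _ _).measure_lt_top.ne,
    padicHaar_real_closedBall, padicHaar_real_closedBall]
  rw [neg_add, zpow_add₀ hp0, zpow_neg_one]
  ring

end helpers

/-- the integral `I_{α,σ}` for `0 < α < 1`. -/
theorem I_alpha_sigma_lt_one (p : ℕ) [Fact p.Prime] (α σ : ℝ) (hα0 : 0 < α) (hα : α < 1)
    (hσ : -1 < σ) (t : ℚ_[p]) (ht : t ≠ 0) :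
    IntegrableOn (fun y => |‖t‖ ^ (α - 1) - ‖y‖ ^ (α - 1)| * ‖y‖ ^ (α * σ))
      {y : ℚ_[p] | ‖y‖ < ‖t‖} (padicHaar p) ∧
    0 < (1 - (p : ℝ)⁻¹) * ((1 - (p : ℝ) ^ (α - 1)) /
        ((1 - (p : ℝ) ^ (-α * σ - 1)) * ((p : ℝ) ^ α - (p : ℝ) ^ (-α * σ)))) *
        (p : ℝ) ^ (-α * σ) ∧
    (∫ y in {y : ℚ_[p] | ‖y‖ < ‖t‖},
        |‖t‖ ^ (α - 1) - ‖y‖ ^ (α - 1)| * ‖y‖ ^ (α * σ) ∂(padicHaar p)) =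
      (1 - (p : ℝ)⁻¹) * ((1 - (p : ℝ) ^ (α - 1)) /
          ((1 - (p : ℝ) ^ (-α * σ - 1)) * ((p : ℝ) ^ α - (p : ℝ) ^ (-α * σ)))) *
        (p : ℝ) ^ (-α * σ) * ‖t‖ ^ (α * (σ + 1)) := by
  have hp1 := padic_one_lt (p := p)
  have hpp : (0 : ℝ) < p := by positivity
  have hp0 : (p : ℝ) ≠ 0 := hpp.ne'
  have hασ : 0 < α * σ + 1 := by nlinarith
  have hασ' : 0 < α * (σ + 1) := by apply mul_pos hα0; linarith
  have hpi : 0 < 1 - (p : ℝ)⁻¹ := by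
    have := inv_lt_one_of_one_lt₀ hp1; linarith
  have e1 : (p : ℝ) ^ (α - 1) < 1 := Real.rpow_lt_one_of_one_lt_of_neg hp1 (by linarith)
  have e2 : (p : ℝ) ^ (-α * σ - 1) < 1 := Real.rpow_lt_one_of_one_lt_of_neg hp1 (by linarith)
  have e3 : (p : ℝ) ^ (-α * σ) < (p : ℝ) ^ α := Real.rpow_lt_rpow_of_exponent_lt hp1 (by linarith)
  have hpos : 0 < (1 - (p : ℝ)⁻¹) * ((1 - (p : ℝ) ^ (α - 1)) /
        ((1 - (p : ℝ) ^ (-α * σ - 1)) * ((p : ℝ) ^ α - (p : ℝ) ^ (-α * σ)))) *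
        (p : ℝ) ^ (-α * σ) := by
    apply mul_pos (mul_pos hpi (div_pos (by linarith) (mul_pos (by linarith) (by linarith))))
    positivity
  set f : ℚ_[p] → ℝ := fun y => |‖t‖ ^ (α - 1) - ‖y‖ ^ (α - 1)| * ‖y‖ ^ (α * σ) with hf
  obtain ⟨m, hm⟩ : ∃ m : ℤ, ‖t‖ = (p : ℝ) ^ (-m) := ⟨_, Padic.norm_eq_zpow_neg_valuation ht⟩
  have hT : 0 < ‖t‖ := norm_pos_iff.2 ht
  set T := ‖t‖ with hTdef
  set S : ℕ → Set ℚ_[p] := fun k => {y | ‖y‖ = (p : ℝ) ^ (-(m + 1 + k))} with hS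
  set a : ℝ := (p : ℝ) ^ (-(α * (σ + 1))) with ha
  set b : ℝ := (p : ℝ) ^ (-α * σ - 1) with hb
  have ha0 : 0 < a := by positivity
  have hb0 : 0 < b := by positivity
  have ha1 : a < 1 := Real.rpow_lt_one_of_one_lt_of_neg hp1 (by linarith)
  have hSm : ∀ k, MeasurableSet (S k) := fun k =>
    (isClosed_eq continuous_norm continuous_const).measurableSet
  have hSfin : ∀ k, padicHaar p (S k) ≠ ⊤ := fun k => by
    refine ((measure_mono ?_).trans_lt
      (isCompact_closedBall (0 : ℚ_[p]) ((p : ℝ) ^ (-(m + 1 + k)))).measure_lt_top).ne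
    intro y hy
    simpa using le_of_eq hy
  have hSd : Pairwise (Function.onFun Disjoint S) := by
    intro i j hij
    rw [Function.onFun, Set.disjoint_left]
    intro y h1 h2
    simp only [hS, Set.mem_ofPred_eq] at h1 h2
    have := zpow_right_injective₀ hpp hp1.ne' (h1.symm.trans h2)
    apply hij
    lia
  have hU : (⋃ k, S k) = {y : ℚ_[p] | ‖y‖ < T} \ {0} := by
    ext y
    simp only [hS, Set.mem_iUnion, Set.mem_ofPred_eq, Set.mem_sdiff, Set.mem_singleton_iff, hm]
    constructor
    · rintro ⟨k, hk⟩
      refine ⟨?_, ?_⟩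
      · rw [hk]; exact zpow_lt_zpow_right₀ hp1 (by lia)
      · rintro rfl
        rw [norm_zero] at hk
        exact (zpow_ne_zero _ hp0) hk.symm
    · rintro ⟨h1, h2⟩
      have h3 := Padic.norm_eq_zpow_neg_valuation h2
      rw [h3] at h1 ⊢
      have h4 := (zpow_lt_zpow_iff_right₀ hp1).1 h1
      refine ⟨(y.valuation - (m + 1)).toNat, ?_⟩
      congr 1
      lia
  have hae : (⋃ k, S k) =ᵐ[padicHaar p] {y : ℚ_[p] | ‖y‖ < T} := by
    rw [hU]
    exact sdiff_null_ae_eq_self (measure_singleton _)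
  have hval : ∀ k : ℕ, ∀ y ∈ S k, f y =
      T ^ (α - 1) * (((p : ℝ) ^ (-((k : ℝ) + 1))) ^ (α - 1) - 1) *
        (T ^ (α * σ) * ((p : ℝ) ^ (-((k : ℝ) + 1))) ^ (α * σ)) := by
    intro k y hy
    have hy' : ‖y‖ = T * (p : ℝ) ^ (-((k : ℝ) + 1)) := by
      rw [hm, ← Real.rpow_intCast, ← Real.rpow_add hpp]
      rw [show ‖y‖ = _ from hy, ← Real.rpow_intCast]
      congr 1
      push_cast
      ring
    have hr : (0 : ℝ) < (p : ℝ) ^ (-((k : ℝ) + 1)) := by positivity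
    have hr1 : 1 ≤ ((p : ℝ) ^ (-((k : ℝ) + 1))) ^ (α - 1) := by
      rw [← Real.rpow_mul hpp.le]
      apply Real.one_le_rpow hp1.le
      have : (0 : ℝ) ≤ k := by positivity
      nlinarith
    simp only [hf, hy']
    rw [Real.mul_rpow hT.le hr.le, Real.mul_rpow hT.le hr.le, abs_sub_comm, abs_of_nonneg]
    · ring
    · have : 0 < T ^ (α - 1) := by positivity
      nlinarith
  have hIntegral : ∀ k : ℕ, ∫ y in S k, f y ∂(padicHaar p) =
      T ^ (α * (σ + 1)) * (1 - (p : ℝ)⁻¹) * (a * a ^ k - b * b ^ k) := by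
    intro k
    rw [setIntegral_congr_fun (hSm k) (hval k), setIntegral_const, smul_eq_mul]
    have hμ : (padicHaar p).real (S k) = T * (p : ℝ) ^ (-((k : ℝ) + 1)) * (1 - (p : ℝ)⁻¹) := by
      rw [show S k = {y : ℚ_[p] | ‖y‖ = (p : ℝ) ^ (-(m + 1 + k))} from rfl,
        padicHaar_real_sphere, hm, ← Real.rpow_intCast, ← Real.rpow_intCast,
        ← Real.rpow_add hpp]
      congr 2
      push_cast
      ring
    rw [hμ]
    have h1 : T ^ (α * (σ + 1)) = T * T ^ (α - 1) * T ^ (α * σ) := by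
      nth_rw 2 [← Real.rpow_one T]
      rw [← Real.rpow_add hT, ← Real.rpow_add hT]
      congr 1
      ring
    set r := (p : ℝ) ^ (-((k : ℝ) + 1)) with hrdef
    have hr : 0 < r := by positivity
    have h2 : a * a ^ k = r * r ^ (α - 1) * r ^ (α * σ) := by
      rw [← pow_succ', ha, hrdef, ← Real.rpow_natCast, ← Real.rpow_mul hpp.le,
        ← Real.rpow_mul hpp.le, ← Real.rpow_mul hpp.le, ← Real.rpow_add hpp, ← Real.rpow_add hpp]
      congr 1
      push_cast
      ring
    have h3 : b * b ^ k = r * r ^ (α * σ) := by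
      rw [← pow_succ', hb, hrdef, ← Real.rpow_natCast, ← Real.rpow_mul hpp.le,
        ← Real.rpow_mul hpp.le, ← Real.rpow_add hpp]
      congr 1
      push_cast
      ring
    rw [h1, h2, h3]
    ring
  have hsum : HasSum (fun k : ℕ => T ^ (α * (σ + 1)) * (1 - (p : ℝ)⁻¹) * (a * a ^ k - b * b ^ k))
      (T ^ (α * (σ + 1)) * (1 - (p : ℝ)⁻¹) * (a * (1 - a)⁻¹ - b * (1 - b)⁻¹)) :=
    (((hasSum_geometric_of_lt_one ha0.le ha1).mul_left a).sub
      ((hasSum_geometric_of_lt_one hb0.le e2).mul_left b)).mul_left _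
  have hfnn : ∀ y, ‖f y‖ = f y := fun y => by
    rw [Real.norm_of_nonneg]
    simp only [hf]
    positivity
  have hI : IntegrableOn f (⋃ k, S k) (padicHaar p) := by
    apply integrableOn_iUnion_of_summable_integral_norm
    · intro k
      exact (integrableOn_congr_fun (hval k) (hSm k)).2 (integrableOn_const (hSfin k))
    · simp only [hfnn, hIntegral]
      exact hsum.summable
  refine ⟨hI.congr_set_ae hae.symm, hpos, ?_⟩
  rw [← setIntegral_congr_set hae]
  have h1 := hasSum_integral_iUnion hSm hSd hI
  simp only [hIntegral] at h1
  rw [h1.unique hsum]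
  have hc : (p : ℝ) ^ (-α * σ) = a * (p : ℝ) ^ α := by
    rw [ha, ← Real.rpow_add hpp]; congr 1; ring
  have hd : a * (p : ℝ) ^ (α - 1) * (p : ℝ) ^ α = b * (p : ℝ) ^ α := by
    rw [ha, hb, ← Real.rpow_add hpp, ← Real.rpow_add hpp, ← Real.rpow_add hpp]; congr 1; ring
  have hP : (0 : ℝ) < (p : ℝ) ^ α := by positivity
  have hd' : b = a * (p : ℝ) ^ (α - 1) := (mul_right_cancel₀ hP.ne' hd).symm
  rw [hc]
  have n1 : 1 - a ≠ 0 := by linarith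
  have n2 : 1 - b ≠ 0 := by linarith
  have n3 : (p : ℝ) ^ α - a * (p : ℝ) ^ α ≠ 0 := by
    have : (p : ℝ) ^ α - a * (p : ℝ) ^ α = (1 - a) * (p : ℝ) ^ α := by ring
    rw [this]; exact mul_ne_zero n1 hP.ne'
  have key : a * (1 - a)⁻¹ - b * (1 - b)⁻¹ = (1 - (p : ℝ) ^ (α - 1)) /
      ((1 - b) * ((p : ℝ) ^ α - a * (p : ℝ) ^ α)) * (a * (p : ℝ) ^ α) := by
    rw [show (p : ℝ) ^ α - a * (p : ℝ) ^ α = (1 - a) * (p : ℝ) ^ α by ring]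
    have : (1 - (p : ℝ) ^ (α - 1)) * a = a - b := by rw [hd']; ring
    have h5 : (1 - (p : ℝ) ^ (α - 1)) / ((1 - b) * ((1 - a) * (p : ℝ) ^ α)) * (a * (p : ℝ) ^ α) =
      ((1 - (p : ℝ) ^ (α - 1)) * a) / ((1 - b) * (1 - a)) := by
      field_simp
    rw [h5, this]
    field_simp
    ring
  rw [key]
  ring
end
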